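/- Let ε ∈ (0,1/2) and a ∈ [1−2ε, 1−ε). For ρ, T > 0 and v : (0,T] → H^{1+ε} with sup_{t≤T} t^{ε/4} ‖v(t)‖_{H^{1+ε}} ≤ ρ, the bound ‖∫₀^t S(t−s) B(v(s),v(s)) ds‖_{H^{1+ε}} ≤ c t^{−ε/4} ρ² t^{(1−a−2ε)/4} holds for all t ∈ (0,T], where c depends only on ε and a. -/

import Mathlib

open MeasureTheory
open scoped ENNReal

/-- Euclidean norm of a lattice point in `ℤ²`. -/
noncomputable def latNorm (m : ℤ × ℤ) : ℝ :=
  Real.sqrt ((m.1 : ℝ)^2 + (m.2 : ℝ)^2)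

/-- The homogeneous `H^s` norm of a mean-zero function on the torus, given through
its Fourier coefficients. -/
noncomputable def HNorm (s : ℝ) (u : ℤ × ℤ → ℂ) : ℝ≥0∞ :=
  (∑' k : {k : ℤ × ℤ // k ≠ 0},
    ENNReal.ofReal (latNorm k.1 ^ (2 * s) * ‖u k.1‖ ^ 2)) ^ (1/2 : ℝ)

/-- Fourier coefficients of `B(u,v) = Δ(∇u · ∇v)`. -/
noncomputable def Bcoef (u v : ℤ × ℤ → ℂ) (k : ℤ × ℤ) : ℂ :=
  -((latNorm k ^ 2 : ℝ) : ℂ) *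
    ∑' p : {p : (ℤ × ℤ) × (ℤ × ℤ) // p.1 + p.2 = k},
      (((p.1.1.1 : ℝ) * p.1.2.1 + (p.1.1.2 : ℝ) * p.1.2.2 : ℝ) : ℂ) *
        u p.1.1 * v p.1.2

/-- Fourier coefficients of the Duhamel term `∫₀^t S(t-s) B(v(s),v(s)) ds` for the
bi-Laplacian semigroup `S(t) = e^{-tΔ²}`. -/
noncomputable def duhamel (v : ℝ → ℤ × ℤ → ℂ) (t : ℝ) (k : ℤ × ℤ) : ℂ :=
  ∫ s in Set.Ioc 0 t,
    (Real.exp (-(t - s) * latNorm k ^ 4) : ℝ) • Bcoef (v s) (v s) k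

/-! ### Cauchy–Schwarz inequalities in `ℝ≥0∞` -/

lemma sq_lintegral_mul_le {α : Type*} [MeasurableSpace α] (μ : Measure α) {f g : α → ℝ≥0∞}
    (hf : AEMeasurable f μ) (hg : AEMeasurable g μ) :
    (∫⁻ x, f x * g x ∂μ) ^ 2 ≤ (∫⁻ x, f x ^ 2 ∂μ) * ∫⁻ x, g x ^ 2 ∂μ := by
  have h := ENNReal.lintegral_mul_le_Lp_mul_Lq μ Real.HolderConjugate.two_two hf hg
  have h2 := pow_le_pow_left' h 2
  rw [mul_pow, ← ENNReal.rpow_natCast (_ ^ (1 / 2 : ℝ)), ← ENNReal.rpow_natCast (_ ^ (1 / 2 : ℝ)),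
    ← ENNReal.rpow_mul, ← ENNReal.rpow_mul] at h2
  norm_num at h2
  exact h2

lemma sq_tsum_mul_le {ι : Type*} (f g : ι → ℝ≥0∞) :
    (∑' i, f i * g i) ^ 2 ≤ (∑' i, f i ^ 2) * ∑' i, g i ^ 2 := by
  let _ : MeasurableSpace ι := ⊤
  have h := sq_lintegral_mul_le Measure.count (f := f) (g := g)
    measurable_from_top.aemeasurable measurable_from_top.aemeasurable
  simpa only [lintegral_count] using h

/-- Bilinear Schur test: a kernel whose rows are uniformly square summable defines a bounded
convolution-type operator `ℓ² × ℓ² → ℓ²`. -/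
lemma tsum_sq_tsum_kernel_le {G : Type*} [AddCommGroup G] (K : G → G → ℝ≥0∞) (f : G → ℝ≥0∞)
    (C : ℝ≥0∞) (hK : ∀ q, ∑' p, K p q ^ 2 ≤ C) :
    ∑' k, (∑' p, K p (k - p) * f p * f (k - p)) ^ 2 ≤ C * (∑' p, f p ^ 2) ^ 2 := by
  calc ∑' k, (∑' p, K p (k - p) * f p * f (k - p)) ^ 2
      ≤ ∑' k, (∑' p, f p ^ 2) * ∑' p, (K p (k - p) * f (k - p)) ^ 2 := by
        refine ENNReal.tsum_le_tsum fun k => ?_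
        refine le_trans (le_of_eq ?_) (sq_tsum_mul_le _ _)
        congr 2 with p
        ring
    _ = (∑' p, f p ^ 2) * ∑' q, (∑' p, K p q ^ 2) * f q ^ 2 := by
        rw [ENNReal.tsum_mul_left, ENNReal.tsum_comm]
        congr 1
        calc ∑' p, ∑' k, (K p (k - p) * f (k - p)) ^ 2
            = ∑' p, ∑' q, (K p q * f q) ^ 2 :=
              tsum_congr fun p => (Equiv.subRight p).tsum_eq fun q => (K p q * f q) ^ 2
          _ = _ := by
              rw [ENNReal.tsum_comm]
              refine tsum_congr fun q => ?_
              rw [← ENNReal.tsum_mul_right]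
              exact tsum_congr fun p => mul_pow _ _ _
    _ ≤ (∑' p, f p ^ 2) * ∑' q, C * f q ^ 2 := by
        gcongr with q
        exact hK q
    _ = C * (∑' p, f p ^ 2) ^ 2 := by
        rw [ENNReal.tsum_mul_left]; ring

/-! ### The lattice norm -/

lemma latNorm_eq_norm (m : ℤ × ℤ) : latNorm m = ‖((m.1 : ℝ) : ℂ) + (m.2 : ℝ) * Complex.I‖ :=
  (Complex.norm_add_mul_I _ _).symm

lemma latNorm_nonneg (m : ℤ × ℤ) : 0 ≤ latNorm m := Real.sqrt_nonneg _

lemma latNorm_sq (m : ℤ × ℤ) : latNorm m ^ 2 = (m.1 : ℝ) ^ 2 + (m.2 : ℝ) ^ 2 :=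
  Real.sq_sqrt (by positivity)

lemma latNorm_zero : latNorm 0 = 0 := by simp [latNorm]

lemma latNorm_neg (m : ℤ × ℤ) : latNorm (-m) = latNorm m := by simp [latNorm]

lemma latNorm_add_le (p q : ℤ × ℤ) : latNorm (p + q) ≤ latNorm p + latNorm q := by
  simp only [latNorm_eq_norm]
  refine le_trans (le_of_eq ?_) (norm_add_le _ _)
  congr 1
  push_cast [Prod.fst_add, Prod.snd_add]
  ring

lemma one_le_latNorm {m : ℤ × ℤ} (hm : m ≠ 0) : 1 ≤ latNorm m := by
  rw [← one_le_sq_iff₀ (latNorm_nonneg m), latNorm_sq]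
  have h : 1 ≤ m.1 ^ 2 + m.2 ^ 2 := by
    by_contra! h
    have h1 : m.1 ^ 2 = 0 := by nlinarith [sq_nonneg m.1, sq_nonneg m.2]
    have h2 : m.2 ^ 2 = 0 := by nlinarith [sq_nonneg m.1, sq_nonneg m.2]
    exact hm (Prod.ext (by simpa using h1) (by simpa using h2))
  exact_mod_cast h

lemma latNorm_pos {m : ℤ × ℤ} (hm : m ≠ 0) : 0 < latNorm m :=
  zero_lt_one.trans_le (one_le_latNorm hm)

lemma abs_fst_le_latNorm (m : ℤ × ℤ) : |(m.1 : ℝ)| ≤ latNorm m :=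
  Real.abs_le_sqrt (by nlinarith [sq_nonneg (m.2 : ℝ)])

lemma abs_snd_le_latNorm (m : ℤ × ℤ) : |(m.2 : ℝ)| ≤ latNorm m :=
  Real.abs_le_sqrt (by nlinarith [sq_nonneg (m.1 : ℝ)])

lemma abs_dot_le_latNorm_mul (p q : ℤ × ℤ) :
    |(p.1 : ℝ) * q.1 + (p.2 : ℝ) * q.2| ≤ latNorm p * latNorm q := by
  refine abs_le_of_sq_le_sq ?_ (mul_nonneg (latNorm_nonneg p) (latNorm_nonneg q))
  rw [mul_pow, latNorm_sq, latNorm_sq]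
  nlinarith [sq_nonneg ((p.1 : ℝ) * q.2 - p.2 * q.1)]

/-! ### Lattice sums of negative powers -/

lemma sum_range_add_one_rpow_neg_le {β : ℝ} (h0 : 0 ≤ β) (h1 : β < 1) (N : ℕ) :
    ∑ n ∈ Finset.range N, ((n : ℝ) + 1) ^ (-β) ≤ (1 - β)⁻¹ * (N : ℝ) ^ (1 - β) := by
  have hγ : 0 < 1 - β := by linarith
  induction N with
  | zero => simp [Real.zero_rpow hγ.ne']
  | succ N ih =>
    have hN : (0 : ℝ) < (N : ℝ) + 1 := by positivity
    have hb : (1 + -(1 / ((N : ℝ) + 1))) ^ (1 - β) ≤ 1 + (1 - β) * -(1 / ((N : ℝ) + 1)) := by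
      refine rpow_one_add_le_one_add_mul_self ?_ hγ.le (by linarith)
      rw [neg_le_neg_iff, div_le_one hN]
      linarith [(Nat.cast_nonneg N : (0 : ℝ) ≤ N)]
    have hf : (N : ℝ) ^ (1 - β)
        = ((N : ℝ) + 1) ^ (1 - β) * (1 + -(1 / ((N : ℝ) + 1))) ^ (1 - β) := by
      rw [← Real.mul_rpow hN.le]
      · congr 1
        field_simp
        ring
      · have : 1 + -(1 / ((N : ℝ) + 1)) = N / (N + 1) := by field_simp; ring
        rw [this]; positivity
    have he : ((N : ℝ) + 1) ^ (1 - β) = ((N : ℝ) + 1) ^ (-β) * (N + 1) := by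
      rw [← Real.rpow_add_one hN.ne']; congr 1; ring
    have hs : (N : ℝ) ^ (1 - β) ≤
        ((N : ℝ) + 1) ^ (1 - β) - (1 - β) * ((N : ℝ) + 1) ^ (-β) := by
      rw [hf]
      refine (mul_le_mul_of_nonneg_left hb (by positivity)).trans (le_of_eq ?_)
      rw [he]
      field_simp
      ring
    rw [Finset.sum_range_succ]
    push_cast
    have := mul_le_mul_of_nonneg_left hs (inv_nonneg.2 hγ.le)
    rw [mul_sub, inv_mul_cancel_left₀ hγ.ne'] at this
    linarith

lemma tsum_nat_rpow_neg_le {β : ℝ} (h0 : 0 ≤ β) (h1 : β < 1) {R : ℝ} (hR : 1 ≤ R) :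
    ∑' n : ℕ, (if (n : ℝ) ≤ R then ENNReal.ofReal (((n : ℝ) + 1) ^ (-β)) else 0) ≤
      ENNReal.ofReal ((1 - β)⁻¹ * (2 * R) ^ (1 - β)) := by
  rw [tsum_eq_sum (s := Finset.range (⌊R⌋₊ + 1))]
  · calc ∑ n ∈ Finset.range (⌊R⌋₊ + 1),
          (if (n : ℝ) ≤ R then ENNReal.ofReal (((n : ℝ) + 1) ^ (-β)) else 0)
        ≤ ∑ n ∈ Finset.range (⌊R⌋₊ + 1), ENNReal.ofReal (((n : ℝ) + 1) ^ (-β)) := by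
          refine Finset.sum_le_sum fun n _ => ?_
          split_ifs <;> simp
      _ = ENNReal.ofReal (∑ n ∈ Finset.range (⌊R⌋₊ + 1), ((n : ℝ) + 1) ^ (-β)) :=
          (ENNReal.ofReal_sum_of_nonneg fun n _ => by positivity).symm
      _ ≤ _ := by
          refine ENNReal.ofReal_le_ofReal ((sum_range_add_one_rpow_neg_le h0 h1 _).trans ?_)
          have hγ : 0 ≤ 1 - β := by linarith
          have := Nat.floor_le (zero_le_one.trans hR)
          gcongr
          push_cast
          linarith
  · intro n hn
    rw [if_neg]
    rw [Finset.mem_range, not_lt] at hn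
    exact not_le.2 (Nat.lt_of_floor_lt (Nat.lt_of_succ_le hn))

lemma tsum_int_rpow_neg_le {β : ℝ} (h0 : 0 ≤ β) (h1 : β < 1) {R : ℝ} (hR : 1 ≤ R) :
    ∑' m : ℤ, (if |(m : ℝ)| ≤ R then ENNReal.ofReal ((|(m : ℝ)| + 1) ^ (-β)) else 0) ≤
      ENNReal.ofReal (4 * (1 - β)⁻¹ * R ^ (1 - β)) := by
  have hγ : 0 < 1 - β := by linarith
  have hR0 : 0 < R := by linarith
  have key := tsum_nat_rpow_neg_le h0 h1 hR
  rw [tsum_of_nat_of_neg_add_one ENNReal.summable ENNReal.summable]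
  calc _ ≤ ENNReal.ofReal ((1 - β)⁻¹ * (2 * R) ^ (1 - β))
        + ENNReal.ofReal ((1 - β)⁻¹ * (2 * R) ^ (1 - β)) := by
        refine add_le_add (le_trans (le_of_eq ?_) key) (le_trans ?_ key)
        · refine tsum_congr fun n => ?_
          simp
        · refine ENNReal.tsum_le_tsum fun n => ?_
          have hc : |((-((n : ℤ) + 1) : ℤ) : ℝ)| = (n : ℝ) + 1 := by
            push_cast
            rw [abs_neg, abs_of_nonneg (by positivity)]
          rw [hc]
          by_cases hn : (n : ℝ) + 1 ≤ R
          · rw [if_pos hn, if_pos (by linarith)]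
            refine ENNReal.ofReal_le_ofReal ?_
            exact Real.rpow_le_rpow_of_nonpos (by positivity) (by linarith) (by linarith)
          · rw [if_neg hn]; exact zero_le
    _ ≤ _ := by
        rw [← ENNReal.ofReal_add (by positivity) (by positivity)]
        refine ENNReal.ofReal_le_ofReal ?_
        rw [Real.mul_rpow (by norm_num) hR0.le]
        have h2 : (2 : ℝ) ^ (1 - β) ≤ 2 := by
          simpa using Real.rpow_le_rpow_of_exponent_le (x := 2) (by norm_num)
            (show 1 - β ≤ 1 by linarith)
        have : (1 - β)⁻¹ * (2 ^ (1 - β) * R ^ (1 - β)) ≤ (1 - β)⁻¹ * (2 * R ^ (1 - β)) := by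
          gcongr
        linarith

/-- `∑_{0 < |p| ≤ R} |p|^{-b} ≲ R^{2-b}` on `ℤ²` when `0 ≤ b < 2`. -/
lemma exists_tsum_latNorm_rpow_neg_le {b : ℝ} (h0 : 0 ≤ b) (h2 : b < 2) :
    ∃ C : ℝ, 0 ≤ C ∧ ∀ R : ℝ, 1 ≤ R →
      ∑' p : ℤ × ℤ, (if p ≠ 0 ∧ latNorm p ≤ R then ENNReal.ofReal (latNorm p ^ (-b)) else 0) ≤
        ENNReal.ofReal (C * R ^ (2 - b)) := by
  have hβ : 0 < 1 - b / 2 := by linarith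
  refine ⟨2 ^ b * (4 * (1 - b / 2)⁻¹) ^ 2, by positivity, fun R hR => ?_⟩
  have hR0 : 0 < R := by linarith
  set g : ℤ → ℝ≥0∞ := fun m =>
    if |(m : ℝ)| ≤ R then ENNReal.ofReal ((|(m : ℝ)| + 1) ^ (-(b / 2))) else 0 with hg
  calc _ ≤ ∑' p : ℤ × ℤ, ENNReal.ofReal (2 ^ b) * (g p.1 * g p.2) := by
        refine ENNReal.tsum_le_tsum fun p => ?_
        split_ifs with hp
        · have hf := abs_fst_le_latNorm p
          have hs := abs_snd_le_latNorm p
          have h1 := one_le_latNorm hp.1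
          have hpos := latNorm_pos hp.1
          simp only [hg, if_pos (hf.trans hp.2), if_pos (hs.trans hp.2)]
          rw [← ENNReal.ofReal_mul (by positivity), ← ENNReal.ofReal_mul (by positivity)]
          refine ENNReal.ofReal_le_ofReal ?_
          have e1 : (2 * latNorm p) ^ (-(b / 2)) ≤ (|(p.1 : ℝ)| + 1) ^ (-(b / 2)) :=
            Real.rpow_le_rpow_of_nonpos (by positivity) (by linarith) (by linarith)
          have e2 : (2 * latNorm p) ^ (-(b / 2)) ≤ (|(p.2 : ℝ)| + 1) ^ (-(b / 2)) :=
            Real.rpow_le_rpow_of_nonpos (by positivity) (by linarith) (by linarith)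
          calc latNorm p ^ (-b)
              = 2 ^ b * ((2 * latNorm p) ^ (-(b / 2)) * (2 * latNorm p) ^ (-(b / 2))) := by
                rw [← Real.rpow_add (by positivity), Real.mul_rpow (by norm_num) hpos.le,
                  ← mul_assoc, ← Real.rpow_add (by norm_num)]
                ring_nf
                simp
            _ ≤ _ := by gcongr
        · exact zero_le
    _ = ENNReal.ofReal (2 ^ b) * ((∑' m, g m) * ∑' m, g m) := by
        rw [ENNReal.tsum_mul_left, ENNReal.tsum_prod (f := fun m n => g m * g n)]
        simp only [ENNReal.tsum_mul_left, ENNReal.tsum_mul_right]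
    _ ≤ ENNReal.ofReal (2 ^ b) * (ENNReal.ofReal (4 * (1 - b / 2)⁻¹ * R ^ (1 - b / 2)) *
          ENNReal.ofReal (4 * (1 - b / 2)⁻¹ * R ^ (1 - b / 2))) := by
        have := tsum_int_rpow_neg_le (β := b / 2) (by linarith) (by linarith) hR
        gcongr
    _ = _ := by
        rw [← ENNReal.ofReal_mul (by positivity), ← ENNReal.ofReal_mul (by positivity)]
        congr 1
        have : R ^ (2 - b) = R ^ (1 - b / 2) * R ^ (1 - b / 2) := by
          rw [← Real.rpow_add hR0]; ring_nf
        rw [this]; ring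

/-! ### The bilinear estimate `H^{1+ε} × H^{1+ε} → H^{-2-a}` -/

/-- The paraproduct piece `|p| ≤ |q|` of the kernel `|p+q|^{-a} |p|^{-ε} |q|^{-ε}`. -/
noncomputable def lowHighKernel (ε a : ℝ) (p q : ℤ × ℤ) : ℝ≥0∞ :=
  if p ≠ 0 ∧ p + q ≠ 0 ∧ latNorm p ≤ latNorm q then
    ENNReal.ofReal (latNorm (p + q) ^ (-a) * latNorm p ^ (-ε) * latNorm q ^ (-ε))
  else 0

lemma half_rpow_neg_le {x y b : ℝ} (hy : 0 < y) (h : y / 2 ≤ x) (h0 : 0 ≤ b) (h1 : b ≤ 1) :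
    x ^ (-(2 * b)) ≤ 4 * y ^ (-(2 * b)) := by
  calc x ^ (-(2 * b)) ≤ (y / 2) ^ (-(2 * b)) :=
        Real.rpow_le_rpow_of_nonpos (by positivity) h (by linarith)
    _ = 2 ^ (2 * b) * y ^ (-(2 * b)) := by
        rw [Real.div_rpow hy.le (by norm_num), Real.rpow_neg (x := 2) (by norm_num)]
        field_simp
    _ ≤ 4 * y ^ (-(2 * b)) := by
        gcongr
        calc (2 : ℝ) ^ (2 * b) ≤ 2 ^ (2 : ℝ) :=
              Real.rpow_le_rpow_of_exponent_le (by norm_num) (by linarith)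
          _ = 4 := by norm_num

lemma sq_rpow_kernel_le {ε a P Q R : ℝ} (hε0 : 0 ≤ ε) (hε1 : ε ≤ 1) (ha0 : 0 ≤ a) (ha1 : a ≤ 1)
    (hP : 0 < P) (hQ : 0 < Q) (hR : 0 < R) (hQPR : Q ≤ P + R) :
    (R ^ (-a) * P ^ (-ε) * Q ^ (-ε)) ^ 2 ≤
      4 * Q ^ (-(2 * ε) - 2 * a) * P ^ (-(2 * ε)) + 4 * Q ^ (-(4 * ε)) * R ^ (-(2 * a)) := by
  have hsq : ∀ {x b : ℝ}, 0 < x → (x ^ (-b)) ^ 2 = x ^ (-(2 * b)) := by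
    intro x b hx
    rw [← Real.rpow_natCast, ← Real.rpow_mul hx.le]
    congr 1
    push_cast
    ring
  rw [mul_pow, mul_pow, hsq hP, hsq hQ, hsq hR]
  rcases le_total (Q / 2) R with h | h
  · have h1 := half_rpow_neg_le hQ h ha0 ha1
    have e : Q ^ (-(2 * ε) - 2 * a) = Q ^ (-(2 * a)) * Q ^ (-(2 * ε)) := by
      rw [← Real.rpow_add hQ]; ring_nf
    calc R ^ (-(2 * a)) * P ^ (-(2 * ε)) * Q ^ (-(2 * ε))
        ≤ 4 * Q ^ (-(2 * a)) * P ^ (-(2 * ε)) * Q ^ (-(2 * ε)) := by gcongr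
      _ = 4 * Q ^ (-(2 * ε) - 2 * a) * P ^ (-(2 * ε)) := by rw [e]; ring
      _ ≤ _ := le_add_of_nonneg_right (by positivity)
  · have h1 := half_rpow_neg_le (x := P) hQ (by linarith) hε0 hε1
    have e : Q ^ (-(4 * ε)) = Q ^ (-(2 * ε)) * Q ^ (-(2 * ε)) := by
      rw [← Real.rpow_add hQ]; ring_nf
    calc R ^ (-(2 * a)) * P ^ (-(2 * ε)) * Q ^ (-(2 * ε))
        ≤ R ^ (-(2 * a)) * (4 * Q ^ (-(2 * ε))) * Q ^ (-(2 * ε)) := by gcongr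
      _ = 4 * Q ^ (-(4 * ε)) * R ^ (-(2 * a)) := by rw [e]; ring
      _ ≤ _ := le_add_of_nonneg_left (by positivity)

lemma exists_tsum_lowHighKernel_sq_le {ε a : ℝ} (hε0 : 0 ≤ ε) (hε1 : ε < 1) (ha0 : 0 ≤ a)
    (ha1 : a < 1) (hεa : 1 ≤ a + 2 * ε) :
    ∃ C : ℝ, 0 ≤ C ∧ ∀ q, ∑' p, lowHighKernel ε a p q ^ 2 ≤ ENNReal.ofReal C := by
  obtain ⟨C₁, hC₁, h₁⟩ := exists_tsum_latNorm_rpow_neg_le (b := 2 * ε) (by linarith) (by linarith)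
  obtain ⟨C₂, hC₂, h₂⟩ := exists_tsum_latNorm_rpow_neg_le (b := 2 * a) (by linarith) (by linarith)
  refine ⟨4 * C₁ + 4 * (C₂ * 2 ^ (2 - 2 * a)), by positivity, fun q => ?_⟩
  rcases eq_or_ne q 0 with rfl | hq
  · have : ∀ p, lowHighKernel ε a p 0 = 0 := fun p =>
      if_neg fun h => (latNorm_pos h.1).not_ge (h.2.2.trans latNorm_zero.le)
    simp [this]
  set Q := latNorm q
  have hQ1 : 1 ≤ Q := one_le_latNorm hq
  have hQ : 0 < Q := latNorm_pos hq
  set A : ℤ × ℤ → ℝ≥0∞ := fun p =>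
    if p ≠ 0 ∧ latNorm p ≤ Q then ENNReal.ofReal (latNorm p ^ (-(2 * ε))) else 0 with hA
  set B : ℤ × ℤ → ℝ≥0∞ := fun p =>
    if p ≠ 0 ∧ latNorm p ≤ 2 * Q then ENNReal.ofReal (latNorm p ^ (-(2 * a))) else 0 with hB
  calc ∑' p, lowHighKernel ε a p q ^ 2
      ≤ ∑' p, (ENNReal.ofReal (4 * Q ^ (-(2 * ε) - 2 * a)) * A p +
          ENNReal.ofReal (4 * Q ^ (-(4 * ε))) * B (p + q)) := by
        refine ENNReal.tsum_le_tsum fun p => ?_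
        rw [lowHighKernel]
        split_ifs with h
        · obtain ⟨hp, hpq, hle⟩ := h
          have hsum := latNorm_add_le p q
          have htri : Q ≤ latNorm p + latNorm (p + q) := by
            have := latNorm_add_le (-p) (p + q)
            rwa [neg_add_cancel_left, latNorm_neg] at this
          have hP := latNorm_pos hp
          have hR := latNorm_pos hpq
          simp only [hA, hB]
          rw [if_pos ⟨hp, hle⟩, if_pos ⟨hpq, by linarith⟩, ← ENNReal.ofReal_mul (by positivity),
            ← ENNReal.ofReal_mul (by positivity), ← ENNReal.ofReal_add (by positivity)
            (by positivity), ← ENNReal.ofReal_pow (by positivity)]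
          exact ENNReal.ofReal_le_ofReal
            (sq_rpow_kernel_le hε0 hε1.le ha0 ha1.le hP hQ hR htri)
        · simp
    _ = ENNReal.ofReal (4 * Q ^ (-(2 * ε) - 2 * a)) * ∑' p, A p +
          ENNReal.ofReal (4 * Q ^ (-(4 * ε))) * ∑' p, B p := by
        rw [ENNReal.tsum_add, ENNReal.tsum_mul_left, ENNReal.tsum_mul_left]
        congr 2
        exact (Equiv.addRight q).tsum_eq B
    _ ≤ ENNReal.ofReal (4 * Q ^ (-(2 * ε) - 2 * a)) * ENNReal.ofReal (C₁ * Q ^ (2 - 2 * ε)) +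
          ENNReal.ofReal (4 * Q ^ (-(4 * ε))) * ENNReal.ofReal (C₂ * (2 * Q) ^ (2 - 2 * a)) := by
        gcongr
        · exact h₁ Q hQ1
        · exact h₂ (2 * Q) (by linarith)
    _ ≤ _ := by
        rw [← ENNReal.ofReal_mul (by positivity), ← ENNReal.ofReal_mul (by positivity),
          ← ENNReal.ofReal_add (by positivity) (by positivity)]
        refine ENNReal.ofReal_le_ofReal ?_
        have hle : Q ^ (2 - 4 * ε - 2 * a) ≤ 1 :=
          Real.rpow_le_one_of_one_le_of_nonpos hQ1 (by linarith)
        have e₁ : Q ^ (-(2 * ε) - 2 * a) * Q ^ (2 - 2 * ε) = Q ^ (2 - 4 * ε - 2 * a) := by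
          rw [← Real.rpow_add hQ]; ring_nf
        have e₂ : Q ^ (-(4 * ε)) * Q ^ (2 - 2 * a) = Q ^ (2 - 4 * ε - 2 * a) := by
          rw [← Real.rpow_add hQ]; ring_nf
        rw [Real.mul_rpow (by norm_num) hQ.le]
        calc _ = (4 * C₁ + 4 * (C₂ * 2 ^ (2 - 2 * a))) * Q ^ (2 - 4 * ε - 2 * a) := by
              rw [add_mul, ← e₁]
              nth_rewrite 2 [e₁]
              rw [← e₂]
              ring
          _ ≤ _ := mul_le_of_le_one_right (by positivity) hle

/-- The absolute convolution `∑_p |p| |u_p| |k-p| |u_{k-p}|` dominating the Fourier coefficients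
of `∇u · ∇u`. -/
noncomputable def gradConv (u : ℤ × ℤ → ℂ) (k : ℤ × ℤ) : ℝ≥0∞ :=
  ∑' p, (ENNReal.ofReal (latNorm p) * ‖u p‖ₑ) *
    (ENNReal.ofReal (latNorm (k - p)) * ‖u (k - p)‖ₑ)

lemma enorm_Bcoef_le (u : ℤ × ℤ → ℂ) (k : ℤ × ℤ) :
    ‖Bcoef u u k‖ₑ ≤ ENNReal.ofReal (latNorm k ^ 2) * gradConv u k := by
  let e : {p : (ℤ × ℤ) × (ℤ × ℤ) // p.1 + p.2 = k} ≃ ℤ × ℤ :=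
    { toFun := fun p => p.1.1
      invFun := fun p => ⟨(p, k - p), add_sub_cancel p k⟩
      left_inv := fun p => Subtype.ext (Prod.ext rfl (sub_eq_of_eq_add' p.2.symm))
      right_inv := fun p => rfl }
  have hk : ‖-((latNorm k ^ 2 : ℝ) : ℂ)‖ₑ = ENNReal.ofReal (latNorm k ^ 2) := by
    rw [enorm_neg, ← ofReal_norm, Complex.norm_real, Real.norm_of_nonneg (by positivity)]
  rw [Bcoef, enorm_mul, hk]
  gcongr
  refine enorm_tsum_le_tsum_enorm.trans ?_
  rw [gradConv, ← e.tsum_eq]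
  refine ENNReal.tsum_le_tsum fun p => ?_
  have hq : k - e p = p.1.2 := sub_eq_of_eq_add' p.2.symm
  rw [hq, enorm_mul, enorm_mul, ← ofReal_norm, Complex.norm_real, Real.norm_eq_abs]
  calc _ ≤ ENNReal.ofReal (latNorm p.1.1 * latNorm p.1.2) * ‖u p.1.1‖ₑ * ‖u p.1.2‖ₑ := by
        gcongr
        exact abs_dot_le_latNorm_mul _ _
    _ = _ := by
        rw [ENNReal.ofReal_mul (latNorm_nonneg _)]
        simp only [e, Equiv.coe_fn_mk]
        ring

lemma HNorm_sq (s : ℝ) (u : ℤ × ℤ → ℂ) :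
    HNorm s u ^ 2 =
      ∑' k : {k : ℤ × ℤ // k ≠ 0}, (ENNReal.ofReal (latNorm k.1 ^ s) * ‖u k.1‖ₑ) ^ 2 := by
  rw [HNorm, ← ENNReal.rpow_natCast, ← ENNReal.rpow_mul]
  norm_num
  refine tsum_congr fun k => ?_
  have hk := latNorm_nonneg k.1
  rw [← ofReal_norm, ← ENNReal.ofReal_mul (by positivity), ← ENNReal.ofReal_pow (by positivity),
    mul_pow, ← Real.rpow_natCast (_ ^ s), ← Real.rpow_mul hk, mul_comm s]
  norm_num

lemma HNorm_sq_eq_tsum {s : ℝ} (hs : s ≠ 0) (u : ℤ × ℤ → ℂ) :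
    HNorm s u ^ 2 = ∑' k, (ENNReal.ofReal (latNorm k ^ s) * ‖u k‖ₑ) ^ 2 := by
  rw [HNorm_sq]
  refine tsum_subtype_eq_of_support_subset
    (f := fun k => (ENNReal.ofReal (latNorm k ^ s) * ‖u k‖ₑ) ^ 2) (s := {k | k ≠ 0}) ?_
  rintro k hk rfl
  simp [latNorm_zero, Real.zero_rpow hs] at hk

lemma rpow_mul_gradConv_le (ε a : ℝ) (u : ℤ × ℤ → ℂ) {k : ℤ × ℤ} (hk : k ≠ 0) :
    ENNReal.ofReal (latNorm k ^ (-a)) * gradConv u k ≤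
      2 * ∑' p, lowHighKernel ε a p (k - p) * (ENNReal.ofReal (latNorm p ^ (1 + ε)) * ‖u p‖ₑ) *
        (ENNReal.ofReal (latNorm (k - p) ^ (1 + ε)) * ‖u (k - p)‖ₑ) := by
  set f : ℤ × ℤ → ℝ≥0∞ := fun p => ENNReal.ofReal (latNorm p ^ (1 + ε)) * ‖u p‖ₑ with hf
  have hsplit : ∀ p, p ≠ 0 →
      ENNReal.ofReal (latNorm p) * ‖u p‖ₑ = ENNReal.ofReal (latNorm p ^ (-ε)) * f p := by
    intro p hp
    have := latNorm_pos hp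
    rw [hf, ← mul_assoc, ← ENNReal.ofReal_mul (by positivity), ← Real.rpow_add this]
    simp
  have hker : ∀ p q, p ≠ 0 → p + q = k → latNorm p ≤ latNorm q →
      ENNReal.ofReal (latNorm k ^ (-a)) * (ENNReal.ofReal (latNorm p ^ (-ε)) *
        ENNReal.ofReal (latNorm q ^ (-ε))) = lowHighKernel ε a p q := by
    rintro p q hp rfl hle
    have h1 := latNorm_nonneg (p + q)
    have h2 := latNorm_nonneg p
    rw [lowHighKernel, if_pos ⟨hp, hk, hle⟩, ENNReal.ofReal_mul (by positivity),
      ENNReal.ofReal_mul (by positivity), mul_assoc]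
  have hswap : ∑' p, lowHighKernel ε a (k - p) p * f p * f (k - p) =
      ∑' p, lowHighKernel ε a p (k - p) * f p * f (k - p) := by
    rw [← (Equiv.subLeft k).tsum_eq]
    refine tsum_congr fun p => ?_
    simp only [Equiv.subLeft_apply, sub_sub_cancel]
    ring
  calc ENNReal.ofReal (latNorm k ^ (-a)) * gradConv u k
      ≤ ∑' p, (lowHighKernel ε a p (k - p) * f p * f (k - p) +
          lowHighKernel ε a (k - p) p * f p * f (k - p)) := by
        rw [gradConv, ← ENNReal.tsum_mul_left]
        refine ENNReal.tsum_le_tsum fun p => ?_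
        rcases eq_or_ne p 0 with rfl | hp
        · simp [latNorm_zero]
        rcases eq_or_ne (k - p) 0 with hq | hq
        · simp [hq, latNorm_zero]
        rw [hsplit p hp, hsplit _ hq]
        rcases le_total (latNorm p) (latNorm (k - p)) with h | h
        · refine le_trans (le_of_eq ?_) le_self_add
          rw [← hker p (k - p) hp (add_sub_cancel p k) h]
          ring
        · refine le_trans (le_of_eq ?_) le_add_self
          rw [← hker (k - p) p hq (sub_add_cancel k p) h]
          ring
    _ = _ := by
        rw [ENNReal.tsum_add, hswap, two_mul]

/-- `‖B(u,u)‖_{H^{-2-a}} ≲ ‖u‖²_{H^{1+ε}}` (in squared form) when `a + 2ε ≥ 1`. -/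
lemma exists_tsum_gradConv_sq_le {ε a : ℝ} (hε0 : 0 ≤ ε) (hε1 : ε < 1) (ha0 : 0 ≤ a)
    (ha1 : a < 1) (hεa : 1 ≤ a + 2 * ε) :
    ∃ C : ℝ, 0 ≤ C ∧ ∀ u : ℤ × ℤ → ℂ,
      ∑' k : {k : ℤ × ℤ // k ≠ 0}, (ENNReal.ofReal (latNorm k.1 ^ (-a)) * gradConv u k.1) ^ 2 ≤
        ENNReal.ofReal C * HNorm (1 + ε) u ^ 4 := by
  obtain ⟨C, hC, hK⟩ := exists_tsum_lowHighKernel_sq_le hε0 hε1 ha0 ha1 hεa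
  refine ⟨4 * C, by positivity, fun u => ?_⟩
  set f : ℤ × ℤ → ℝ≥0∞ := fun p => ENNReal.ofReal (latNorm p ^ (1 + ε)) * ‖u p‖ₑ
  calc _ ≤ ∑' k : {k : ℤ × ℤ // k ≠ 0},
          (2 * ∑' p, lowHighKernel ε a p (k.1 - p) * f p * f (k.1 - p)) ^ 2 := by
        refine ENNReal.tsum_le_tsum fun k => ?_
        exact pow_le_pow_left' (rpow_mul_gradConv_le ε a u k.2) 2
    _ ≤ ∑' k, (2 * ∑' p, lowHighKernel ε a p (k - p) * f p * f (k - p)) ^ 2 :=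
        ENNReal.tsum_comp_le_tsum_of_injective Subtype.val_injective
          fun k => (2 * ∑' p, lowHighKernel ε a p (k - p) * f p * f (k - p)) ^ 2
    _ = 4 * ∑' k, (∑' p, lowHighKernel ε a p (k - p) * f p * f (k - p)) ^ 2 := by
        simp only [mul_pow, ENNReal.tsum_mul_left]
        norm_num
    _ ≤ 4 * (ENNReal.ofReal C * (∑' p, f p ^ 2) ^ 2) := by
        gcongr
        exact tsum_sq_tsum_kernel_le _ _ _ hK
    _ = _ := by
        rw [← HNorm_sq_eq_tsum (by linarith), ENNReal.ofReal_mul (by norm_num)]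
        norm_num
        ring

/-! ### Time integration -/

/-- The smoothing estimate for the multiplier `e^{-x|k|⁴}`. -/
lemma exp_neg_mul_rpow_le {x κ r : ℝ} (hx : 0 < x) (hκ : 0 < κ) (h0 : 0 ≤ r) (h1 : r ≤ 4) :
    Real.exp (-x * κ ^ 4) * κ ^ r ≤ x ^ (-(r / 4)) := by
  set z := x * κ ^ 4 with hz
  have hz0 : 0 < z := by positivity
  have hzle : z ^ (r / 4) ≤ Real.exp z := by
    refine le_trans ?_ (Real.add_one_le_exp z)
    rcases le_total z 1 with h | h
    · exact (Real.rpow_le_one hz0.le h (by linarith)).trans (by linarith)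
    · calc z ^ (r / 4) ≤ z ^ (1 : ℝ) := Real.rpow_le_rpow_of_exponent_le h (by linarith)
        _ ≤ z + 1 := by rw [Real.rpow_one]; linarith
  have hκr : κ ^ r = x ^ (-(r / 4)) * z ^ (r / 4) := by
    rw [hz, Real.mul_rpow hx.le (by positivity), ← mul_assoc, ← Real.rpow_add hx,
      ← Real.rpow_natCast, ← Real.rpow_mul hκ.le]
    norm_num
    congr 1
    ring
  calc Real.exp (-x * κ ^ 4) * κ ^ r
      = x ^ (-(r / 4)) * (Real.exp (-z) * z ^ (r / 4)) := by
        rw [hκr, neg_mul]; ring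
    _ ≤ x ^ (-(r / 4)) * (Real.exp (-z) * Real.exp z) := by gcongr
    _ = x ^ (-(r / 4)) := by rw [← Real.exp_add]; simp

lemma lintegral_rpow_neg {τ t : ℝ} (hτ : τ < 1) (ht : 0 < t) :
    ∫⁻ s in Set.Ioo 0 t, ENNReal.ofReal (s ^ (-τ)) =
      ENNReal.ofReal (t ^ (1 - τ) / (1 - τ)) := by
  rw [restrict_Ioo_eq_restrict_Ioc]
  have hi : IntervalIntegrable (fun s : ℝ => s ^ (-τ)) volume 0 t :=
    intervalIntegral.intervalIntegrable_rpow' (by linarith)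
  rw [← ofReal_integral_eq_lintegral_ofReal
    ((intervalIntegrable_iff_integrableOn_Ioc_of_le ht.le).1 hi),
    ← intervalIntegral.integral_of_le ht.le, integral_rpow (Or.inl (by linarith))]
  · rw [Real.zero_rpow (by linarith)]
    ring_nf
  · filter_upwards [ae_restrict_mem measurableSet_Ioc] with s hs
    exact Real.rpow_nonneg hs.1.le _

lemma lintegral_sub_rpow_neg {σ t : ℝ} (hσ : σ < 1) (ht : 0 < t) :
    ∫⁻ s in Set.Ioo 0 t, ENNReal.ofReal ((t - s) ^ (-σ)) =
      ENNReal.ofReal (t ^ (1 - σ) / (1 - σ)) := by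
  rw [← lintegral_rpow_neg hσ ht, ← lintegral_indicator measurableSet_Ioo,
    ← lintegral_indicator measurableSet_Ioo,
    ← lintegral_sub_left_eq_self _ t]
  refine lintegral_congr fun s => ?_
  have hmem : t - s ∈ Set.Ioo 0 t ↔ s ∈ Set.Ioo 0 t := by
    simp only [Set.mem_Ioo, sub_pos, sub_lt_self_iff]
    exact and_comm
  by_cases hs : s ∈ Set.Ioo 0 t
  · rw [Set.indicator_of_mem hs, Set.indicator_of_mem (hmem.2 hs), sub_sub_cancel]
  · rw [Set.indicator_of_notMem hs, Set.indicator_of_notMem (hmem.not.2 hs)]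

/-- A bound for the Beta-type integral `∫₀ᵗ (t-s)^{-σ} s^{-τ} ds`. -/
lemma lintegral_sub_rpow_mul_rpow_le {σ τ t : ℝ} (hσ0 : 0 ≤ σ) (hσ : σ < 1) (hτ0 : 0 ≤ τ)
    (hτ : τ < 1) (ht : 0 < t) :
    ∫⁻ s in Set.Ioo 0 t, ENNReal.ofReal ((t - s) ^ (-σ) * s ^ (-τ)) ≤
      ENNReal.ofReal ((2 / (1 - τ) + 2 / (1 - σ)) * t ^ (1 - σ - τ)) := by
  have hσ' : 0 < 1 - σ := by linarith
  have hτ' : 0 < 1 - τ := by linarith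
  have hhalf : ∀ {x b : ℝ}, t / 2 ≤ x → 0 ≤ b → b < 1 → x ^ (-b) ≤ 2 * t ^ (-b) := by
    intro x b hx h0 h1
    calc x ^ (-b) ≤ (t / 2) ^ (-b) :=
          Real.rpow_le_rpow_of_nonpos (by positivity) hx (by linarith)
      _ = 2 ^ b * t ^ (-b) := by
          rw [Real.div_rpow ht.le (by norm_num), Real.rpow_neg (x := 2) (by norm_num)]
          field_simp
      _ ≤ 2 * t ^ (-b) := by
          gcongr
          simpa using Real.rpow_le_rpow_of_exponent_le (x := 2) (by norm_num) h1.le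
  calc ∫⁻ s in Set.Ioo 0 t, ENNReal.ofReal ((t - s) ^ (-σ) * s ^ (-τ))
      ≤ ∫⁻ s in Set.Ioo 0 t, (ENNReal.ofReal (2 * t ^ (-σ)) * ENNReal.ofReal (s ^ (-τ)) +
          ENNReal.ofReal (2 * t ^ (-τ)) * ENNReal.ofReal ((t - s) ^ (-σ))) := by
        refine setLIntegral_mono' measurableSet_Ioo fun s hs => ?_
        have h1 : 0 < s := hs.1
        have h2 : 0 < t - s := sub_pos.2 hs.2
        rw [← ENNReal.ofReal_mul (by positivity), ← ENNReal.ofReal_mul (by positivity),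
          ← ENNReal.ofReal_add (by positivity) (by positivity)]
        refine ENNReal.ofReal_le_ofReal ?_
        rcases le_total s (t / 2) with h | h
        · refine le_add_of_le_of_nonneg ?_ (by positivity)
          gcongr
          exact hhalf (by linarith) hσ0 hσ
        · refine le_add_of_nonneg_of_le (by positivity) ?_
          rw [mul_comm]
          gcongr
          exact hhalf h hτ0 hτ
    _ = ENNReal.ofReal (2 * t ^ (-σ)) * ENNReal.ofReal (t ^ (1 - τ) / (1 - τ)) +
          ENNReal.ofReal (2 * t ^ (-τ)) * ENNReal.ofReal (t ^ (1 - σ) / (1 - σ)) := by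
        rw [lintegral_add_left (by fun_prop), lintegral_const_mul _ (by fun_prop),
          lintegral_const_mul _ (by fun_prop), lintegral_rpow_neg hτ ht,
          lintegral_sub_rpow_neg hσ ht]
    _ = _ := by
        rw [← ENNReal.ofReal_mul (by positivity), ← ENNReal.ofReal_mul (by positivity),
          ← ENNReal.ofReal_add (by positivity) (by positivity)]
        congr 1
        have e₁ : t ^ (1 - σ - τ) = t ^ (-σ) * t ^ (1 - τ) := by
          rw [← Real.rpow_add ht]; ring_nf
        have e₂ : t ^ (1 - σ - τ) = t ^ (-τ) * t ^ (1 - σ) := by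
          rw [← Real.rpow_add ht]; ring_nf
        rw [add_mul]
        nth_rewrite 1 [e₁]
        rw [e₂]
        ring

/-- Minkowski-type inequality: an `ℓ²` bound `‖β(s)‖ ≤ M s^{-τ}` is propagated through a
convolution in time with `(t-s)^{-σ}`. -/
lemma tsum_sq_lintegral_le {ι : Type*} [Countable ι] {σ τ t : ℝ} (M : ℝ≥0∞)
    {β : ι → ℝ → ℝ≥0∞} (hβ : ∀ i, Measurable (β i))
    (hM : ∀ s ∈ Set.Ioo 0 t, ∑' i, β i s ^ 2 ≤ M * ENNReal.ofReal (s ^ (-(2 * τ)))) :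
    ∑' i, (∫⁻ s in Set.Ioo 0 t, ENNReal.ofReal ((t - s) ^ (-σ)) * β i s) ^ 2 ≤
      M * (∫⁻ s in Set.Ioo 0 t, ENNReal.ofReal ((t - s) ^ (-σ) * s ^ (-τ))) ^ 2 := by
  set I := ∫⁻ s in Set.Ioo 0 t, ENNReal.ofReal ((t - s) ^ (-σ) * s ^ (-τ))
  have hsq : ∀ {x b : ℝ}, 0 < x → (x ^ (b / 2)) ^ 2 = x ^ b := by
    intro x b hx
    rw [← Real.rpow_natCast, ← Real.rpow_mul hx.le]
    norm_num
  have hsingle : ∀ i, (∫⁻ s in Set.Ioo 0 t, ENNReal.ofReal ((t - s) ^ (-σ)) * β i s) ^ 2 ≤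
      I * ∫⁻ s in Set.Ioo 0 t, ENNReal.ofReal ((t - s) ^ (-σ) * s ^ τ) * β i s ^ 2 := by
    intro i
    have hcs := sq_lintegral_mul_le (volume.restrict (Set.Ioo 0 t))
      (f := fun s => ENNReal.ofReal ((t - s) ^ (-σ / 2) * s ^ (-τ / 2)))
      (g := fun s => ENNReal.ofReal ((t - s) ^ (-σ / 2) * s ^ (τ / 2)) * β i s)
      (by fun_prop) (by fun_prop)
    convert hcs using 2
    · refine setLIntegral_congr_fun measurableSet_Ioo fun s hs => ?_
      have h1 : 0 < s := hs.1
      have h2 : 0 < t - s := sub_pos.2 hs.2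
      rw [← mul_assoc, ← ENNReal.ofReal_mul (by positivity)]
      congr 2
      rw [mul_mul_mul_comm, ← Real.rpow_add h1, ← Real.rpow_add h2]
      ring_nf
      simp
    · refine setLIntegral_congr_fun measurableSet_Ioo fun s hs => ?_
      have h1 : 0 < s := hs.1
      have h2 : 0 < t - s := sub_pos.2 hs.2
      rw [← ENNReal.ofReal_pow (by positivity), mul_pow, hsq h1, hsq h2]
    · refine setLIntegral_congr_fun measurableSet_Ioo fun s hs => ?_
      have h1 : 0 < s := hs.1
      have h2 : 0 < t - s := sub_pos.2 hs.2
      rw [mul_pow, ← ENNReal.ofReal_pow (by positivity), mul_pow, hsq h1, hsq h2]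
  calc _ ≤ ∑' i, I * ∫⁻ s in Set.Ioo 0 t, ENNReal.ofReal ((t - s) ^ (-σ) * s ^ τ) * β i s ^ 2 :=
        ENNReal.tsum_le_tsum hsingle
    _ = I * ∫⁻ s in Set.Ioo 0 t,
          ENNReal.ofReal ((t - s) ^ (-σ) * s ^ τ) * ∑' i, β i s ^ 2 := by
        rw [ENNReal.tsum_mul_left, ← lintegral_tsum fun i => by fun_prop]
        simp only [ENNReal.tsum_mul_left]
    _ ≤ I * ∫⁻ s in Set.Ioo 0 t, M * ENNReal.ofReal ((t - s) ^ (-σ) * s ^ (-τ)) := by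
        refine mul_le_mul' le_rfl ?_
        refine setLIntegral_mono' measurableSet_Ioo fun s hs => ?_
        have h1 : 0 < s := hs.1
        have h2 : 0 < t - s := sub_pos.2 hs.2
        calc _ ≤ ENNReal.ofReal ((t - s) ^ (-σ) * s ^ τ) *
                (M * ENNReal.ofReal (s ^ (-(2 * τ)))) := by
              gcongr
              exact hM s hs
          _ = _ := by
              rw [mul_left_comm, ← ENNReal.ofReal_mul (by positivity), mul_assoc,
                ← Real.rpow_add h1]
              ring_nf
    _ = M * I ^ 2 := by
        rw [lintegral_const_mul _ (by fun_prop)]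
        ring

lemma measurable_gradConv {v : ℝ → ℤ × ℤ → ℂ} (hv : ∀ k, Measurable fun s => v s k) (k : ℤ × ℤ) :
    Measurable fun s => gradConv (v s) k := by
  unfold gradConv
  exact Measurable.tsum fun p => by
    have h1 := hv p
    have h2 := hv (k - p)
    fun_prop

lemma rpow_mul_enorm_duhamel_le {ε a : ℝ} (h0 : 0 ≤ 3 + ε + a) (h1 : ε + a ≤ 1)
    (v : ℝ → ℤ × ℤ → ℂ) (t : ℝ) {k : ℤ × ℤ} (hk : k ≠ 0) :
    ENNReal.ofReal (latNorm k ^ (1 + ε)) * ‖duhamel v t k‖ₑ ≤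
      ∫⁻ s in Set.Ioo 0 t, ENNReal.ofReal ((t - s) ^ (-((3 + ε + a) / 4))) *
        (ENNReal.ofReal (latNorm k ^ (-a)) * gradConv (v s) k) := by
  have hκ := latNorm_pos hk
  calc _ ≤ ENNReal.ofReal (latNorm k ^ (1 + ε)) * ∫⁻ s in Set.Ioo 0 t,
          ‖(Real.exp (-(t - s) * latNorm k ^ 4) : ℝ) • Bcoef (v s) (v s) k‖ₑ := by
        gcongr
        rw [duhamel, restrict_Ioo_eq_restrict_Ioc]
        exact enorm_integral_le_lintegral_enorm _
    _ = ∫⁻ s in Set.Ioo 0 t, ENNReal.ofReal (latNorm k ^ (1 + ε)) *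
          ‖(Real.exp (-(t - s) * latNorm k ^ 4) : ℝ) • Bcoef (v s) (v s) k‖ₑ :=
        (lintegral_const_mul' _ _ ENNReal.ofReal_ne_top).symm
    _ ≤ _ := by
        refine setLIntegral_mono' measurableSet_Ioo fun s hs => ?_
        have h2 : 0 < t - s := sub_pos.2 hs.2
        have hsm := exp_neg_mul_rpow_le h2 hκ h0 (by linarith)
        have hpow : latNorm k ^ (1 + ε) * latNorm k ^ 2 =
            latNorm k ^ (3 + ε + a) * latNorm k ^ (-a) := by
          rw [← Real.rpow_natCast, ← Real.rpow_add hκ, ← Real.rpow_add hκ]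
          congr 1
          push_cast
          ring
        rw [enorm_smul, Real.enorm_of_nonneg (Real.exp_pos _).le]
        calc _ ≤ ENNReal.ofReal (latNorm k ^ (1 + ε)) *
                (ENNReal.ofReal (Real.exp (-(t - s) * latNorm k ^ 4)) *
                  (ENNReal.ofReal (latNorm k ^ 2) * gradConv (v s) k)) := by
              gcongr
              exact enorm_Bcoef_le _ _
          _ = ENNReal.ofReal (Real.exp (-(t - s) * latNorm k ^ 4) * latNorm k ^ (3 + ε + a)) *
                (ENNReal.ofReal (latNorm k ^ (-a)) * gradConv (v s) k) := by
              rw [← mul_assoc, ← mul_assoc, ← mul_assoc, ← ENNReal.ofReal_mul (by positivity),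
                ← ENNReal.ofReal_mul (by positivity), ← ENNReal.ofReal_mul (by positivity)]
              congr 2
              rw [mul_right_comm, hpow]
              ring
          _ ≤ _ := by gcongr

/-- Quadratic Duhamel estimate: if `sup_{t ≤ T} t^{ε/4} ‖v(t)‖_{H^{1+ε}} ≤ ρ`, then
`‖∫₀^t S(t-s) B(v(s),v(s)) ds‖_{H^{1+ε}} ≤ c t^{-ε/4} ρ² t^{(1-a-2ε)/4}`
for all `t ∈ (0,T]`, with `c = c(ε,a)`. -/
theorem duhamel_quadratic_estimate (ε a : ℝ) (hε : ε ∈ Set.Ioo (0:ℝ) (1/2))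
    (ha : a ∈ Set.Ico (1 - 2 * ε) (1 - ε)) :
    ∃ c : ℝ, 0 < c ∧ ∀ ρ T : ℝ, 0 < ρ → 0 < T →
      ∀ v : ℝ → ℤ × ℤ → ℂ, (∀ k, Measurable (fun s => v s k)) →
      (∀ t ∈ Set.Ioc (0:ℝ) T,
        ENNReal.ofReal (t ^ (ε / 4)) * HNorm (1 + ε) (v t) ≤ ENNReal.ofReal ρ) →
      ∀ t ∈ Set.Ioc (0:ℝ) T,
        HNorm (1 + ε) (duhamel v t) ≤
          ENNReal.ofReal (c * t ^ (-(ε / 4)) * ρ ^ 2 * t ^ ((1 - a - 2 * ε) / 4)) := by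
  obtain ⟨hε0, hε1⟩ := hε
  obtain ⟨ha0, ha1⟩ := ha
  obtain ⟨C, hC, hbil⟩ := exists_tsum_gradConv_sq_le (ε := ε) (a := a) hε0.le (by linarith)
    (by linarith) (by linarith) (by linarith)
  have hσ : 0 < 1 - (3 + ε + a) / 4 := by linarith
  have hτ : 0 < 1 - ε / 2 := by linarith
  set D := 2 / (1 - ε / 2) + 2 / (1 - (3 + ε + a) / 4)
  have hD0 : 0 < D := by positivity
  refine ⟨Real.sqrt (C + 1) * D, by positivity, fun ρ T hρ _ v hv hbound t ht => ?_⟩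
  have ht0 : 0 < t := ht.1
  have hv4 : ∀ s ∈ Set.Ioo 0 t,
      HNorm (1 + ε) (v s) ^ 4 ≤ ENNReal.ofReal (ρ ^ 4) * ENNReal.ofReal (s ^ (-(2 * (ε / 2)))) := by
    intro s hs
    have hs0 : 0 < s := hs.1
    have h := hbound s ⟨hs0, hs.2.le.trans ht.2⟩
    have hle : HNorm (1 + ε) (v s) ≤ ENNReal.ofReal (ρ * s ^ (-(ε / 4))) := by
      calc HNorm (1 + ε) (v s)
          = ENNReal.ofReal (s ^ (-(ε / 4))) *
              (ENNReal.ofReal (s ^ (ε / 4)) * HNorm (1 + ε) (v s)) := by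
            rw [← mul_assoc, ← ENNReal.ofReal_mul (by positivity), ← Real.rpow_add hs0]
            simp
        _ ≤ ENNReal.ofReal (s ^ (-(ε / 4))) * ENNReal.ofReal ρ := by gcongr
        _ = _ := by rw [← ENNReal.ofReal_mul (by positivity), mul_comm]
    refine (pow_le_pow_left' hle 4).trans (le_of_eq ?_)
    rw [← ENNReal.ofReal_pow (by positivity), ← ENNReal.ofReal_mul (by positivity), mul_pow,
      ← Real.rpow_natCast (_ ^ (-(ε / 4))), ← Real.rpow_mul hs0.le]
    congr 3
    push_cast
    ring
  have hsq : HNorm (1 + ε) (duhamel v t) ^ 2 ≤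
      (ENNReal.ofReal (Real.sqrt (C + 1) * D * t ^ (-(ε / 4)) * ρ ^ 2 *
        t ^ ((1 - a - 2 * ε) / 4))) ^ 2 := by
    calc HNorm (1 + ε) (duhamel v t) ^ 2
        ≤ ∑' k : {k : ℤ × ℤ // k ≠ 0}, (∫⁻ s in Set.Ioo 0 t,
            ENNReal.ofReal ((t - s) ^ (-((3 + ε + a) / 4))) *
              (ENNReal.ofReal (latNorm k.1 ^ (-a)) * gradConv (v s) k.1)) ^ 2 := by
          rw [HNorm_sq]
          refine ENNReal.tsum_le_tsum fun k => ?_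
          gcongr
          exact rpow_mul_enorm_duhamel_le (by linarith) (by linarith) v t k.2
      _ ≤ ENNReal.ofReal (C * ρ ^ 4) * (∫⁻ s in Set.Ioo 0 t,
            ENNReal.ofReal ((t - s) ^ (-((3 + ε + a) / 4)) * s ^ (-(ε / 2)))) ^ 2 := by
          refine tsum_sq_lintegral_le _ (fun k => (measurable_gradConv hv k.1).const_mul _)
            fun s hs => (hbil (v s)).trans ?_
          rw [ENNReal.ofReal_mul hC, mul_assoc]
          gcongr
          exact hv4 s hs
      _ ≤ ENNReal.ofReal ((C + 1) * ρ ^ 4) *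
            ENNReal.ofReal (D * t ^ (1 - (3 + ε + a) / 4 - ε / 2)) ^ 2 := by
          gcongr
          · linarith
          · exact lintegral_sub_rpow_mul_rpow_le (by linarith) (by linarith) (by linarith)
              (by linarith) ht0
      _ = _ := by
          rw [← ENNReal.ofReal_pow (by positivity), ← ENNReal.ofReal_pow (by positivity),
            ← ENNReal.ofReal_mul (by positivity)]
          congr 1
          have he : t ^ (1 - (3 + ε + a) / 4 - ε / 2) =
              t ^ (-(ε / 4)) * t ^ ((1 - a - 2 * ε) / 4) := by
            rw [← Real.rpow_add ht0]
            congr 1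
            ring
          have hs : Real.sqrt (C + 1) ^ 2 = C + 1 := Real.sq_sqrt (by linarith)
          rw [he]
          simp only [mul_pow, hs]
          ring
  exact (ENNReal.pow_le_pow_left_iff two_ne_zero).1 hsq
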